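/- arXiv:math/0605168 — 2 statements merged into one kernel-verified Lean document; each statement's English description precedes it below -/
import Mathlib

section
/- Let π, p : ℤ_{>0} → [0,1] be probability distributions, both of class 𝓔, with p aperiodic. Let u_n = ∑_{m=1}^∞ p^{*m}(n), Q_{ij} = u_{j−i} for i < j and 0 otherwise, and K_{ij} = π_i + ∑_{i'=1}^{i-1} π_{i'} u_{i−i'} − Q_{ji}. Then there exist positive constants C₁, C₂, C₃, β, γ such that |K_{ij}| ≤ C₁ for all i ≤ j, and |K_{ij}| ≤ C₂ e^{−β(i−j)} + C₃ e^{−γ i} for all i > j. -/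
open scoped BigOperators

/-- `m`-fold convolution power of a distribution `p` on `ℕ` (supported on `ℤ_{>0}`). -/
def convPow (p : ℕ → ℝ) : ℕ → ℕ → ℝ
  | 0 => fun n => if n = 0 then 1 else 0
  | m + 1 => fun n => ∑ k ∈ Finset.range (n + 1), convPow p m k * p (n - k)

/-- The renewal sequence `u n = ∑_{m≥1} p^{*m}(n)` of `p`. -/
noncomputable def renewalSeq (p : ℕ → ℝ) (n : ℕ) : ℝ :=
  ∑' m : ℕ, convPow p (m + 1) n

/-- The matrix `Q` of the delayed renewal process: `Q i j = u (j - i)` for `i < j`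
and `Q i j = 0` otherwise. -/
noncomputable def Qren (p : ℕ → ℝ) (i j : ℕ) : ℝ :=
  if i < j then renewalSeq p (j - i) else 0

/-- The correlation kernel `K i j = π i + ∑_{i'=1}^{i-1} π i' · u (i - i') - Q j i`
of the delayed renewal process. -/
noncomputable def Kren (π p : ℕ → ℝ) (i j : ℕ) : ℝ :=
  π i + (∑ i' ∈ Finset.Ico 1 i, π i' * renewalSeq p (i - i')) - Qren p j i

/-- Coefficients of the reciprocal of a power series that converges on a disc of radius `r⁻¹ > 1`
and does not vanish on the unit circle decay exponentially, as soon as they are bounded. -/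
lemma exists_geometric_bound_of_mul_eq_one {f h : ℕ → ℝ} {r A B : ℝ} (hr0 : 0 < r) (hr1 : r < 1)
    (hf : ∀ n, |f n| ≤ B) (hh : ∀ n, |h n| ≤ A * r ^ n)
    (hfh : PowerSeries.mk f * PowerSeries.mk h = 1)
    (hne : ∀ z : ℂ, ‖z‖ = 1 → ∑' n, (h n : ℂ) * z ^ n ≠ 0) :
    ∃ C ρ : ℝ, 0 ≤ C ∧ r < ρ ∧ ρ < 1 ∧ ∀ n, |f n| ≤ C * ρ ^ n := by
  set H : ℂ → ℂ := fun z => ∑' n, (h n : ℂ) * z ^ n with hH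
  set R₁ : ℝ := 2 / (1 + r) with hR₁
  have hR₁1 : 1 < R₁ := by rw [hR₁, lt_div_iff₀ (by linarith)]; linarith
  have hrR : r * R₁ < 1 := by rw [hR₁, mul_div_assoc', div_lt_one (by linarith)]; linarith
  have hHbound : ∀ n, ∀ z : ℂ, ‖z‖ ≤ R₁ → ‖(h n : ℂ) * z ^ n‖ ≤ A * (r * R₁) ^ n := by
    intro n z hz
    rw [norm_mul, norm_pow, Complex.norm_real, Real.norm_eq_abs, mul_pow, ← mul_assoc]
    have := (abs_nonneg _).trans (hh n)
    gcongr
    exact hh n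
  have hgeom : Summable fun n : ℕ => A * (r * R₁) ^ n :=
    (summable_geometric_of_lt_one (by positivity) hrR).mul_left A
  have hHdiff : DifferentiableOn ℂ H (Metric.ball 0 R₁) :=
    Complex.differentiableOn_tsum_of_summable_norm hgeom (fun n => by fun_prop)
      Metric.isOpen_ball (fun n z hz => hHbound n z (by simpa using (mem_ball_zero_iff.1 hz).le))
  have hFsum : ∀ z : ℂ, ‖z‖ < 1 → Summable fun n => ‖(f n : ℂ) * z ^ n‖ := by
    intro z hz
    refine Summable.of_nonneg_of_le (fun n => norm_nonneg _) (fun n => ?_)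
      ((summable_geometric_of_lt_one (norm_nonneg z) hz).mul_left B)
    rw [norm_mul, norm_pow, Complex.norm_real, Real.norm_eq_abs]
    gcongr
    exact hf n
  have hmul : ∀ z : ℂ, ‖z‖ < 1 → (∑' n, (f n : ℂ) * z ^ n) * H z = 1 := by
    intro z hz
    rw [hH, tsum_mul_tsum_eq_tsum_sum_antidiagonal_of_summable_norm (hFsum z hz)
      (hgeom.of_nonneg_of_le (fun n => norm_nonneg _)
        (fun n => hHbound n z (hz.le.trans hR₁1.le))), tsum_eq_single 0]
    · have := congrArg (PowerSeries.coeff 0) hfh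
      simp [PowerSeries.coeff_mul] at this
      simp [← Complex.ofReal_mul, this]
    · intro n hn
      have := congrArg (PowerSeries.coeff n) hfh
      simp only [PowerSeries.coeff_mul, PowerSeries.coeff_mk, PowerSeries.coeff_one, if_neg hn]
        at this
      have h2 : ((∑ x ∈ Finset.HasAntidiagonal.antidiagonal n, f x.1 * h x.2 : ℝ) : ℂ) * z ^ n = 0 := by simp [this]
      rw [← h2, Complex.ofReal_sum, Finset.sum_mul]
      refine Finset.sum_congr rfl fun x hx => ?_
      rw [← Finset.HasAntidiagonal.mem_antidiagonal.1 hx, pow_add]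
      push_cast
      ring
  obtain ⟨δ, hδ, hsub⟩ := (isCompact_closedBall (0 : ℂ) 1).exists_thickening_subset_open
    (hHdiff.continuousOn.isOpen_inter_preimage Metric.isOpen_ball
      (isOpen_compl_singleton (x := (0 : ℂ)))) (by
    intro z hz
    have hz' : ‖z‖ ≤ 1 := by simpa using hz
    refine ⟨by simpa using hz'.trans_lt hR₁1, ?_⟩
    rcases hz'.lt_or_eq with h1 | h1
    · exact right_ne_zero_of_mul_eq_one (hmul z h1)
    · exact hne z h1)
  rw [thickening_closedBall hδ zero_le_one] at hsub
  obtain ⟨R, hR1, hR⟩ : ∃ R : NNReal, 1 < (R : ℝ) ∧ (R : ℝ) < min (δ + 1) R₁ := by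
    obtain ⟨x, hx1, hx2⟩ := exists_between (lt_min (by linarith : 1 < δ + 1) hR₁1)
    exact ⟨⟨x, by linarith⟩, hx1, hx2⟩
  obtain ⟨hRδ, hRR⟩ := lt_min_iff.1 hR
  have hball : Metric.closedBall (0 : ℂ) R ⊆ Metric.ball 0 (δ + 1) :=
    Metric.closedBall_subset_ball hRδ
  have hG : DifferentiableOn ℂ (fun z => (H z)⁻¹) (Metric.closedBall 0 R) :=
    DifferentiableOn.fun_inv (hHdiff.mono fun z hz => (hsub (hball hz)).1)
      fun z hz => (hsub (hball hz)).2
  have hGs := hG.hasFPowerSeriesOnBall (by exact_mod_cast zero_lt_one.trans hR1)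
  set q := FormalMultilinearSeries.ofScalars ℂ (fun n => (f n : ℂ)) with hq
  have hqrad : 0 < q.radius := lt_of_lt_of_le (by simp)
    (q.le_radius_of_bound B (r := 1) fun n => by
      rw [hq, FormalMultilinearSeries.ofScalars_norm]; simpa using hf n)
  have hqs : HasFPowerSeriesAt (fun z => (H z)⁻¹) q 0 := by
    refine (q.hasFPowerSeriesOnBall hqrad).hasFPowerSeriesAt.congr ?_
    filter_upwards [Metric.ball_mem_nhds (0 : ℂ) one_pos] with z hz
    refine eq_inv_of_mul_eq_one_left ((congrArg (· * H z) ?_).trans (hmul z (by simpa using hz)))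
    simp [FormalMultilinearSeries.sum, hq, mul_comm]
  have heq := hqs.eq_formalMultilinearSeries hGs.hasFPowerSeriesAt
  refine ⟨(2 * Real.pi)⁻¹ * ∫ θ in (0 : ℝ)..2 * Real.pi, ‖(H (circleMap 0 R θ))⁻¹‖, (R : ℝ)⁻¹,
    ?_, ?_, inv_lt_one_of_one_lt₀ hR1, fun n => ?_⟩
  · have : 0 ≤ ∫ θ in (0 : ℝ)..2 * Real.pi, ‖(H (circleMap 0 R θ))⁻¹‖ :=
      intervalIntegral.integral_nonneg (by positivity) fun _ _ => norm_nonneg _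
    positivity
  · rw [lt_inv_comm₀ hr0 (by linarith)]
    refine hRR.trans ?_
    rw [lt_inv_comm₀ (by linarith) hr0, ← one_div, lt_div_iff₀ (by linarith)]
    exact hrR
  · have := norm_cauchyPowerSeries_le (fun z => (H z)⁻¹) 0 R n
    rw [← heq, hq, FormalMultilinearSeries.ofScalars_norm, Complex.norm_real, NNReal.abs_eq] at this
    exact this

/-- A distribution with exponentially small values has exponentially small values and tails, with
a common constant. -/
lemma exists_geometric_bound_of_dist {q : ℕ → ℝ} (hq0 : ∀ n, 0 ≤ q n) (hq1 : ∀ n, q n ≤ 1)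
    (hqsum : ∑' n, q n = 1) {r : ℝ} (hr0 : 0 < r) (hr1 : r < 1) {N₀ : ℕ}
    (hq : ∀ n ≥ N₀, q n ≤ r ^ n) :
    ∃ A : ℝ, 0 ≤ A ∧ (∀ n, q n ≤ A * r ^ n) ∧
      ∀ n, |1 - ∑ k ∈ Finset.range (n + 1), q k| ≤ A * r ^ n := by
  have hs : Summable q := by
    by_contra h
    simp [tsum_eq_zero_of_not_summable h] at hqsum
  have hr' : 0 < 1 - r := by linarith
  set A : ℝ := (r ^ N₀)⁻¹
  have hA1 : 1 ≤ A := one_le_inv₀ (by positivity) |>.2 (pow_le_one₀ hr0.le hr1.le)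
  have hqA : ∀ n, q n ≤ A * r ^ n := by
    intro n
    rcases le_total N₀ n with h | h
    · exact (hq n h).trans (le_mul_of_one_le_left (by positivity) hA1)
    · refine (hq1 n).trans ?_
      rw [inv_mul_eq_div, one_le_div (by positivity)]
      exact pow_le_pow_of_le_one hr0.le hr1.le h
  have hAA : A ≤ A * (1 - r)⁻¹ :=
    le_mul_of_one_le_right (by linarith) (one_le_inv₀ hr' |>.2 (by linarith))
  refine ⟨A * (1 - r)⁻¹, by positivity, fun n => (hqA n).trans (by gcongr), fun n => ?_⟩
  have h1 := hs.sum_add_tsum_nat_add (n + 1)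
  have h2 : 1 - ∑ k ∈ Finset.range (n + 1), q k = ∑' k, q (k + (n + 1)) := by linarith
  rw [h2, mul_right_comm, ← Real.norm_eq_abs]
  refine tsum_of_norm_bounded (g := fun k => A * r ^ n * r ^ k)
    ((hasSum_geometric_of_lt_one hr0.le hr1).mul_left _) fun k => ?_
  rw [Real.norm_of_nonneg (hq0 _), mul_assoc, ← pow_add]
  refine (hqA _).trans ?_
  have : r ^ (k + (n + 1)) ≤ r ^ (n + k) := pow_le_pow_of_le_one hr0.le hr1.le (by omega)
  gcongr

/-- Partial sums of an exponentially small sequence converge exponentially fast. -/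
lemma exists_geometric_bound_sum_range_sub {f : ℕ → ℝ} {C ρ : ℝ} (hρ0 : 0 ≤ ρ) (hρ1 : ρ < 1)
    (hC : 0 ≤ C) (hf : ∀ n, |f n| ≤ C * ρ ^ n) (n : ℕ) :
    |∑ k ∈ Finset.range (n + 1), f k - ∑' k, f k| ≤ C * (1 - ρ)⁻¹ * ρ ^ n := by
  have hs : Summable f := Summable.of_norm_bounded
    ((summable_geometric_of_lt_one hρ0 hρ1).mul_left C) hf
  rw [← hs.sum_add_tsum_nat_add (n + 1), sub_add_cancel_left, abs_neg, mul_right_comm, ← Real.norm_eq_abs]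
  refine tsum_of_norm_bounded (g := fun k => C * ρ ^ n * ρ ^ k)
    ((hasSum_geometric_of_lt_one hρ0 hρ1).mul_left _) fun k => ?_
  rw [mul_assoc, ← pow_add]
  refine (hf _).trans ?_
  have : ρ ^ (k + (n + 1)) ≤ ρ ^ (n + k) := pow_le_pow_of_le_one hρ0 hρ1.le (by omega)
  gcongr

open PowerSeries in
lemma convPow_eq_coeff (p : ℕ → ℝ) (m n : ℕ) : convPow p m n = coeff n ((mk p) ^ m) := by
  induction m generalizing n with
  | zero => simp [convPow, coeff_one]
  | succ m ih =>
    simp [convPow, pow_succ, coeff_mul, Finset.Nat.sum_antidiagonal_eq_sum_range_succ_mk, ih]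

lemma convPow_nonneg {p : ℕ → ℝ} (hp : ∀ n, 0 ≤ p n) (m n : ℕ) : 0 ≤ convPow p m n := by
  induction m generalizing n with
  | zero => simp only [convPow]; split_ifs <;> norm_num
  | succ m ih => exact Finset.sum_nonneg fun k _ => mul_nonneg (ih k) (hp _)

open PowerSeries in
lemma one_sub_mk_mul_inv {p : ℕ → ℝ} (hp0 : p 0 = 0) : (1 - mk p) * (1 - mk p)⁻¹ = 1 :=
  PowerSeries.mul_inv_cancel _ (by simp [hp0])

open PowerSeries in
lemma coeff_mk_pow_mul_eq_zero {p : ℕ → ℝ} (hp0 : p 0 = 0) (φ : PowerSeries ℝ) {m n : ℕ}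
    (h : n < m) : coeff n ((mk p) ^ m * φ) = 0 := by
  have hX : (X : PowerSeries ℝ) ∣ mk p := by
    rw [X_dvd_iff, ← coeff_zero_eq_constantCoeff_apply, coeff_mk, hp0]
  exact X_pow_dvd_iff.1 ((pow_dvd_pow_of_dvd hX m).mul_right φ) n h

open PowerSeries in
lemma coeff_inv_one_sub_mk {p : ℕ → ℝ} (hp0 : p 0 = 0) (n : ℕ) :
    coeff n (1 - mk p)⁻¹ = ∑ m ∈ Finset.range (n + 1), convPow p m n := by
  have h : (1 - mk p)⁻¹ = ∑ m ∈ Finset.range (n + 1), (mk p) ^ m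
      + (mk p) ^ (n + 1) * (1 - mk p)⁻¹ := by
    have h1 := one_sub_mk_mul_inv hp0
    have h2 := mul_neg_geom_sum (mk p) (n + 1)
    linear_combination (∑ m ∈ Finset.range (n + 1), (mk p) ^ m) * h1 - (1 - mk p)⁻¹ * h2
  rw [h, map_add, coeff_mk_pow_mul_eq_zero hp0 _ n.lt_succ_self, add_zero, map_sum]
  simp only [convPow_eq_coeff]

open PowerSeries in
/-- The renewal sequence is given by the coefficients of the generating function `1 / (1 - P)`. -/
lemma renewalSeq_eq_coeff {p : ℕ → ℝ} (hp0 : p 0 = 0) {n : ℕ} (hn : n ≠ 0) :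
    renewalSeq p n = coeff n (1 - mk p)⁻¹ := by
  rw [coeff_inv_one_sub_mk hp0, Finset.sum_range_succ', renewalSeq, tsum_eq_sum (s := .range n)]
  · simp [convPow, hn]
  · intro m hm
    have := coeff_mk_pow_mul_eq_zero hp0 1 (Nat.lt_succ_of_le (not_lt.1 (mt Finset.mem_range.2 hm)))
    rwa [mul_one, ← convPow_eq_coeff] at this

open PowerSeries in
lemma mk_tail_mul_one_sub_X (p : ℕ → ℝ) :
    mk (fun n => 1 - ∑ k ∈ Finset.range (n + 1), p k) * (1 - X) = 1 - mk p := by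
  ext n
  cases n with
  | zero => simp [mul_sub]
  | succ n =>
    simp only [mul_sub, mul_one, map_sub, coeff_succ_mul_X, coeff_mk, coeff_one,
      Finset.sum_range_succ _ (n + 1)]
    simp

open PowerSeries in
lemma coeff_inv_one_sub_mk_mem_Icc {p : ℕ → ℝ} (hp0 : p 0 = 0) (hp : ∀ n, 0 ≤ p n)
    (htail : ∀ n, ∑ k ∈ Finset.range n, p k ≤ 1) (n : ℕ) :
    coeff n (1 - mk p)⁻¹ ∈ Set.Icc (0 : ℝ) 1 := by
  have hnn : ∀ n, 0 ≤ coeff n (1 - mk p)⁻¹ := fun n => by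
    rw [coeff_inv_one_sub_mk hp0]
    exact Finset.sum_nonneg fun m _ => convPow_nonneg hp m n
  refine ⟨hnn n, ?_⟩
  have h : (1 - mk p)⁻¹ * mk (fun n => 1 - ∑ k ∈ Finset.range (n + 1), p k) = mk 1 := by
    linear_combination (mk 1 * (1 - mk p)⁻¹) * mk_tail_mul_one_sub_X p
      + mk 1 * one_sub_mk_mul_inv hp0
      - ((1 - mk p)⁻¹ * mk (fun n => 1 - ∑ k ∈ Finset.range (n + 1), p k))
        * mk_one_mul_one_sub_eq_one ℝ
  have hn := congrArg (coeff n) h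
  simp only [coeff_mul, Finset.Nat.sum_antidiagonal_eq_sum_range_succ_mk, coeff_mk,
    Finset.sum_range_succ _ n, Pi.one_apply, Nat.sub_self] at hn
  have : 0 ≤ ∑ k ∈ Finset.range n, coeff k (1 - mk p)⁻¹
      * (1 - ∑ j ∈ Finset.range (n - k + 1), p j) :=
    Finset.sum_nonneg fun k _ => mul_nonneg (hnn k) (sub_nonneg.2 (htail _))
  simp [hp0] at hn
  linarith

/-- The only point of the unit circle at which the generating function of an aperiodic
distribution can take the value `1` is `1`. -/
lemma eq_one_of_hasSum_aperiodic {p : ℕ → ℝ} (hp0 : p 0 = 0) (hp : ∀ n, 0 ≤ p n)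
    (hpsum : HasSum p 1) (haper : ∀ N : ℕ, 2 ≤ N → ∃ n, 0 < p n ∧ ¬ N ∣ n) {z : ℂ}
    (hz : ‖z‖ = 1) (h : HasSum (fun n => (p n : ℂ) * z ^ n) 1) : z = 1 := by
  have hre : HasSum (fun n => p n * (1 - (z ^ n).re)) 0 := by
    have := hpsum.sub (Complex.hasSum_re h)
    simpa [mul_sub] using this
  have hle : ∀ n, (z ^ n).re ≤ 1 := fun n =>
    (Complex.re_le_norm _).trans (by simp [hz])
  have hzero := (hasSum_zero_iff_of_nonneg
    fun n => mul_nonneg (hp n) (sub_nonneg.2 (hle n))).1 hre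
  have hpow : ∀ n, 0 < p n → orderOf z ∣ n := by
    intro n hn
    have h1 : (z ^ n).re = 1 := by
      have := congrFun hzero n
      simp only [Pi.zero_apply, mul_eq_zero, hn.ne', false_or] at this
      linarith
    have h2 : (z ^ n).im = 0 := by
      have := Complex.sq_norm (z ^ n)
      rw [norm_pow, hz, Complex.normSq_apply, h1] at this
      simpa using this
    exact orderOf_dvd_of_pow_eq_one (Complex.ext (by simpa using h1) (by simpa using h2))
  rw [← orderOf_eq_one_iff]
  by_contra hne
  rcases Nat.eq_zero_or_pos (orderOf z) with h0 | h0
  · obtain ⟨n, hn, -⟩ := haper 2 le_rfl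
    have := hpow n hn
    rw [h0, zero_dvd_iff] at this
    simp [this, hp0] at hn
  · obtain ⟨n, hn, hdvd⟩ := haper (orderOf z) (by omega)
    exact hdvd (hpow n hn)

/-- The generating function of the tails of an aperiodic distribution does not vanish on the unit
circle. -/
lemma tsum_tail_mul_pow_ne_zero {p : ℕ → ℝ} (hp0 : p 0 = 0) (hp : ∀ n, 0 ≤ p n)
    (hpsum : HasSum p 1) (haper : ∀ N : ℕ, 2 ≤ N → ∃ n, 0 < p n ∧ ¬ N ∣ n)
    (hs : Summable fun n => 1 - ∑ k ∈ Finset.range (n + 1), p k) {z : ℂ} (hz : ‖z‖ = 1) :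
    ∑' n, ((1 - ∑ k ∈ Finset.range (n + 1), p k : ℝ) : ℂ) * z ^ n ≠ 0 := by
  set h : ℕ → ℝ := fun n => 1 - ∑ k ∈ Finset.range (n + 1), p k with hh
  have hnn : ∀ n, 0 ≤ h n := fun n =>
    sub_nonneg.2 (sum_le_hasSum _ (fun k _ => hp k) hpsum)
  have hh0 : h 0 = 1 := by simp [hh, hp0]
  intro hzero
  change ∑' n, (h n : ℂ) * z ^ n = 0 at hzero
  have hsz : Summable fun n => (h n : ℂ) * z ^ n :=
    Summable.of_norm_bounded hs fun n => by simp [hz, abs_of_nonneg (hnn n)]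
  have hH : HasSum (fun n => (h n : ℂ) * z ^ n) 0 := hzero ▸ hsz.hasSum
  have hH1 : HasSum (fun n => (h (n + 1) : ℂ) * z ^ (n + 1)) (-1) := by
    rw [hasSum_nat_add_iff (f := fun n => (h n : ℂ) * z ^ n) 1]
    simpa [hh0] using hH
  have hP : HasSum (fun n => (p n : ℂ) * z ^ n) 1 := by
    have := (hH.mul_left z).sub hH1
    rw [← hasSum_nat_add_iff' 1]
    convert this using 1
    · funext n
      have : h (n + 1) = h n - p (n + 1) := by
        simp only [hh, Finset.sum_range_succ _ (n + 1)]; ring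
      rw [this]
      push_cast
      ring
    · simp [hp0]
  have hz1 := eq_one_of_hasSum_aperiodic hp0 hp hpsum haper hz hP
  have hsum : HasSum h 0 := by
    simp only [hz1, one_pow, mul_one] at hH
    simpa using Complex.hasSum_re hH
  have := congrFun ((hasSum_zero_iff_of_nonneg hnn).1 hsum) 0
  simp [hh0] at this

open PowerSeries in
/-- The renewal theorem with exponential rate. -/
lemma exists_geometric_bound_renewal {p : ℕ → ℝ} (hp0 : p 0 = 0) (hp : ∀ n, 0 ≤ p n)
    (hpsum : HasSum p 1) (haper : ∀ N : ℕ, 2 ≤ N → ∃ n, 0 < p n ∧ ¬ N ∣ n) {r A : ℝ}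
    (hr0 : 0 < r) (hr1 : r < 1)
    (htail : ∀ n, |1 - ∑ k ∈ Finset.range (n + 1), p k| ≤ A * r ^ n) :
    ∃ μ D ρ : ℝ, 0 ≤ D ∧ r < ρ ∧ ρ < 1 ∧
      ∀ n, |coeff n (1 - mk p)⁻¹ - μ| ≤ D * ρ ^ n := by
  set U : PowerSeries ℝ := (1 - mk p)⁻¹ with hU
  have hU01 := coeff_inv_one_sub_mk_mem_Icc hp0 hp
    fun n => sum_le_hasSum (Finset.range n) (fun k _ => hp k) hpsum
  set f : ℕ → ℝ := fun n => coeff n (U * (1 - X)) with hf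
  have hmk : mk f = U * (1 - X) := by ext n; simp [hf]
  have hf0 : f 0 = coeff 0 U := by simp [hf, mul_sub]
  have hfs : ∀ n, f (n + 1) = coeff (n + 1) U - coeff n U := fun n => by
    simp [hf, mul_sub, coeff_succ_mul_X]
  have hf1 : ∀ n, |f n| ≤ 1 := by
    intro n
    cases n with
    | zero => rw [hf0, abs_of_nonneg (hU01 0).1]; exact (hU01 0).2
    | succ n =>
      rw [hfs, abs_le]
      constructor <;> linarith [(hU01 n).1, (hU01 n).2, (hU01 (n + 1)).1, (hU01 (n + 1)).2]
  have hsum : ∀ n, ∑ k ∈ Finset.range (n + 1), f k = coeff n U := by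
    intro n
    induction n with
    | zero => simp [hf0]
    | succ n ih => rw [Finset.sum_range_succ, ih, hfs]; ring
  obtain ⟨C, ρ, hC, hrρ, hρ1, hfC⟩ := exists_geometric_bound_of_mul_eq_one hr0 hr1 hf1 htail
    (by
      rw [hmk]
      linear_combination U * mk_tail_mul_one_sub_X p + one_sub_mk_mul_inv hp0)
    (fun z hz => tsum_tail_mul_pow_ne_zero hp0 hp hpsum haper (Summable.of_norm_bounded
      ((summable_geometric_of_lt_one hr0.le hr1).mul_left A) htail) hz)
  have hρ' : 0 < 1 - ρ := by linarith
  refine ⟨∑' k, f k, C * (1 - ρ)⁻¹, ρ, by positivity, hrρ, hρ1, fun n => ?_⟩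
  rw [← hsum]
  exact exists_geometric_bound_sum_range_sub (hr0.trans hrρ).le hρ1 hC hfC n

/-- Convolving a distribution with exponential tails with a sequence that converges exponentially
fast yields a sequence that converges exponentially fast to the same limit. -/
lemma abs_conv_sub_le {q u : ℕ → ℝ} {r ρ A D μ : ℝ} (hr0 : 0 < r) (hrρ : r < ρ)
    (hA : 0 ≤ A) (hD : 0 ≤ D) (hq0 : ∀ n, 0 ≤ q n) (hq : ∀ n, q n ≤ A * r ^ n)
    (htail : ∀ n, |1 - ∑ k ∈ Finset.range (n + 1), q k| ≤ A * r ^ n)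
    (hu : ∀ n, |u n - μ| ≤ D * ρ ^ n) (i : ℕ) :
    |∑ k ∈ Finset.range (i + 1), q k * u (i - k) - μ| ≤
      (A * D * (1 - r / ρ)⁻¹ + |μ| * A) * ρ ^ i := by
  have hρ : 0 < ρ := hr0.trans hrρ
  have hsplit : ∑ k ∈ Finset.range (i + 1), q k * u (i - k) - μ =
      ∑ k ∈ Finset.range (i + 1), q k * (u (i - k) - μ)
        - μ * (1 - ∑ k ∈ Finset.range (i + 1), q k) := by
    simp only [mul_sub, Finset.sum_sub_distrib, ← Finset.sum_mul]
    ring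
  have h1 : |∑ k ∈ Finset.range (i + 1), q k * (u (i - k) - μ)| ≤
      A * D * ρ ^ i * (1 - r / ρ)⁻¹ := by
    have hgeom := hasSum_geometric_of_lt_one (r := r / ρ) (by positivity) ((div_lt_one hρ).2 hrρ)
    calc |∑ k ∈ Finset.range (i + 1), q k * (u (i - k) - μ)|
        ≤ ∑ k ∈ Finset.range (i + 1), A * D * ρ ^ i * (r / ρ) ^ k := by
          refine (Finset.abs_sum_le_sum_abs _ _).trans (Finset.sum_le_sum fun k hk => ?_)
          rw [abs_mul, abs_of_nonneg (hq0 k)]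
          calc q k * |u (i - k) - μ| ≤ (A * r ^ k) * (D * ρ ^ (i - k)) :=
                mul_le_mul (hq k) (hu _) (abs_nonneg _) (by positivity)
            _ = A * D * ρ ^ i * (r / ρ) ^ k := by
                rw [pow_sub₀ _ hρ.ne' (Nat.lt_succ_iff.1 (Finset.mem_range.1 hk)), div_pow]
                field_simp
      _ ≤ A * D * ρ ^ i * (1 - r / ρ)⁻¹ := by
          rw [← Finset.mul_sum]
          gcongr
          exact sum_le_hasSum _ (fun k _ => by positivity) hgeom
  have h2 : |μ * (1 - ∑ k ∈ Finset.range (i + 1), q k)| ≤ |μ| * (A * ρ ^ i) := by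
    rw [abs_mul]
    gcongr
    exact (htail i).trans (by gcongr)
  rw [hsplit]
  calc _ ≤ _ := abs_sub _ _
    _ ≤ A * D * ρ ^ i * (1 - r / ρ)⁻¹ + |μ| * (A * ρ ^ i) := add_le_add h1 h2
    _ = _ := by ring

open PowerSeries in
lemma Kren_eq {π p : ℕ → ℝ} (hπ0 : π 0 = 0) (hp0 : p 0 = 0) {i : ℕ} (hi : 1 ≤ i) (j : ℕ) :
    Kren π p i j = ∑ k ∈ Finset.range (i + 1), π k * coeff (i - k) (1 - mk p)⁻¹
      - if j < i then coeff (i - j) (1 - mk p)⁻¹ else 0 := by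
  have h0 : coeff 0 (1 - mk p)⁻¹ = 1 := by simp [coeff_inv_one_sub_mk hp0, convPow]
  have hQ : Qren p j i = if j < i then coeff (i - j) (1 - mk p)⁻¹ else 0 := by
    unfold Qren
    split_ifs with h
    · exact renewalSeq_eq_coeff hp0 (by omega)
    · rfl
  have hsum : ∑ k ∈ Finset.Ico 1 i, π k * renewalSeq p (i - k) =
      ∑ k ∈ Finset.range i, π k * coeff (i - k) (1 - mk p)⁻¹ := by
    rw [Finset.range_eq_Ico, Finset.sum_eq_sum_Ico_succ_bot hi, hπ0, zero_mul, zero_add]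
    refine Finset.sum_congr rfl fun k hk => ?_
    rw [renewalSeq_eq_coeff hp0 (by have := (Finset.mem_Ico.1 hk).2; omega)]
  rw [Kren, hQ, hsum, Finset.sum_range_succ, Nat.sub_self, h0]
  ring

/-- Entrywise bounds on the correlation kernel of the delayed renewal process
(proof of Theorem 4.1): `|K i j| ≤ C₁` for `i ≤ j`, and
`|K i j| ≤ C₂ e^{-β(i-j)} + C₃ e^{-γ i}` for `i > j`. -/
theorem delayed_renewal_kernel_entry_bounds (π p : ℕ → ℝ)
    (hπ0 : π 0 = 0) (hπnonneg : ∀ n, 0 ≤ π n) (hπle : ∀ n, π n ≤ 1)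
    (hπsum : ∑' n, π n = 1)
    (hp0 : p 0 = 0) (hpnonneg : ∀ n, 0 ≤ p n) (hple : ∀ n, p n ≤ 1)
    (hpsum : ∑' n, p n = 1)
    (r : ℝ) (hr : r ∈ Set.Ioo (0 : ℝ) 1) (N₀ : ℕ)
    (hπtail : ∀ n ≥ N₀, π n ≤ r ^ n) (hptail : ∀ n ≥ N₀, p n ≤ r ^ n)
    (haper : ∀ N : ℕ, 2 ≤ N → ∃ n, 0 < p n ∧ ¬ N ∣ n) :
    ∃ C₁ > (0 : ℝ), ∃ C₂ > (0 : ℝ), ∃ C₃ > (0 : ℝ), ∃ β > (0 : ℝ), ∃ γ > (0 : ℝ),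
      (∀ i j : ℕ, 1 ≤ i → i ≤ j → |Kren π p i j| ≤ C₁) ∧
      (∀ i j : ℕ, 1 ≤ j → j < i →
        |Kren π p i j| ≤ C₂ * Real.exp (-β * ((i : ℝ) - (j : ℝ))) +
          C₃ * Real.exp (-γ * (i : ℝ))) := by
  obtain ⟨hr0, hr1⟩ := hr
  have hp : HasSum p 1 := by
    have hs : Summable p := by
      by_contra h
      simp [tsum_eq_zero_of_not_summable h] at hpsum
    exact hpsum ▸ hs.hasSum
  have hπ : HasSum π 1 := by
    have hs : Summable π := by
      by_contra h
      simp [tsum_eq_zero_of_not_summable h] at hπsum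
    exact hπsum ▸ hs.hasSum
  obtain ⟨A, hA, hπA, hπt⟩ := exists_geometric_bound_of_dist hπnonneg hπle hπsum hr0 hr1 hπtail
  obtain ⟨B, -, -, hpt⟩ := exists_geometric_bound_of_dist hpnonneg hple hpsum hr0 hr1 hptail
  obtain ⟨μ, D, ρ, hD, hrρ, hρ1, hu⟩ :=
    exists_geometric_bound_renewal hp0 hpnonneg hp haper hr0 hr1 hpt
  have hρ : 0 < ρ := hr0.trans hrρ
  have hlog : 0 < -Real.log ρ := neg_pos.2 (Real.log_neg hρ hρ1)
  have hexp : ∀ n : ℕ, Real.exp (-(-Real.log ρ) * n) = ρ ^ n := fun n => by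
    rw [neg_neg, mul_comm, Real.exp_nat_mul, Real.exp_log hρ]
  have hrρ' : 0 < 1 - r / ρ := sub_pos.2 ((div_lt_one hρ).2 hrρ)
  have hU := coeff_inv_one_sub_mk_mem_Icc hp0 hpnonneg
    fun n => sum_le_hasSum (Finset.range n) (fun k _ => hpnonneg k) hp
  refine ⟨1, one_pos, D + 1, by positivity, A * D * (1 - r / ρ)⁻¹ + |μ| * A + 1, by positivity,
    -Real.log ρ, hlog, -Real.log ρ, hlog, fun i j hi hij => ?_, fun i j hj hij => ?_⟩
  · rw [Kren_eq hπ0 hp0 hi, if_neg hij.not_gt, sub_zero,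
      abs_of_nonneg (Finset.sum_nonneg fun k _ => mul_nonneg (hπnonneg k) (hU _).1)]
    exact (Finset.sum_le_sum fun k _ => mul_le_of_le_one_right (hπnonneg k) (hU _).2).trans
      (sum_le_hasSum _ (fun k _ => hπnonneg k) hπ)
  · rw [Kren_eq hπ0 hp0 (by omega), if_pos hij, ← Nat.cast_sub hij.le, hexp, hexp]
    have h1 := abs_conv_sub_le hr0 hrρ hA hD hπnonneg hπA hπt hu i
    have h2 := hu (i - j)
    have h3 := abs_sub_le (∑ k ∈ Finset.range (i + 1),
      π k * PowerSeries.coeff (i - k) (1 - PowerSeries.mk p)⁻¹) μ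
      (PowerSeries.coeff (i - j) (1 - PowerSeries.mk p)⁻¹)
    rw [abs_sub_comm μ] at h3
    have h4 : 0 < ρ ^ (i - j) := by positivity
    have h5 : 0 < ρ ^ i := by positivity
    linarith
end

section
/- Let S be a finite set and, for each pair s, s' ∈ S, let P_{ss'}(·) : ℤ_{>0} → [0,1] satisfy ∑_{s'∈S} ∑_{t=1}^∞ P_{ss'}(t) = 1 for every s. Set P_{ss'} = ∑_{t≥1} P_{ss'}(t), and assume: (a) the driving chain with transition matrix [P_{ss'}] is irreducible; (b) whenever P_{ss'} ≠ 0, there exist r ∈ (0,1) and T₀ with P_{ss'}(t)/P_{ss'} ≤ r^t for all t ≥ T₀. Consider the Markov chain on S × ℤ_{≥0} with transition probabilities P((s_1,t_1) → (s_2,t_2)) = P_{s_1 s_2}(t_2 − t_1), started at (s, 0), realized as a probability measure on (S × ℤ_{≥0})^ℕ. For s' ∈ S let τ be the ℤ-coordinate of the chain at the first step n ≥ 1 at which its S-coordinate equals s' (the first passage time from s to s'). Then there exists ρ ∈ (0,1) such that Prob{τ = T} ≤ ρ^T for all sufficiently large T; i.e., the first passage time from s to s' is of class 𝓔. -/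
open scoped BigOperators
open MeasureTheory

open Filter Topology

/-- The weight of the first `n` steps of the path `x`, for the chain started at `(s, 0)`. -/
noncomputable def pathWeight {S : Type*} [DecidableEq S] (Pt : S → S → ℕ → ℝ) (s : S) (n : ℕ)
    (x : ℕ → S × ℕ) : ℝ :=
  (if x 0 = (s, 0) then (1 : ℝ) else 0) *
    ∏ i ∈ Finset.range n, Pt (x i).1 (x (i + 1)).1 ((x (i + 1)).2 - (x i).2)

/-- The set of trajectories that agree with `x` up to index `n`. -/
def agreeUpTo {α : Type*} (n : ℕ) (x : ℕ → α) : Set (ℕ → α) := {ω | ∀ i ≤ n, ω i = x i}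

/-- The set of trajectories whose first visit to `s'` after index `n` occurs at time `T`. -/
def passageAfter {S : Type*} (s' : S) (T n : ℕ) : Set (ℕ → S × ℕ) :=
  {ω | ∃ m : ℕ, n + 1 ≤ m ∧ (∀ k : ℕ, n + 1 ≤ k → k < m → (ω k).1 ≠ s') ∧ ω m = (s', T)}

lemma pathWeight_nonneg {S : Type*} [DecidableEq S] {Pt : S → S → ℕ → ℝ}
    (hPt : ∀ a b t, 0 ≤ Pt a b t) (s : S) (n : ℕ) (x : ℕ → S × ℕ) :
    0 ≤ pathWeight Pt s n x :=
  mul_nonneg (by split_ifs <;> norm_num) (Finset.prod_nonneg fun _ _ => hPt _ _ _)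

lemma pathWeight_update {S : Type*} [DecidableEq S] (Pt : S → S → ℕ → ℝ) (s : S) (n : ℕ)
    (x : ℕ → S × ℕ) (q : S × ℕ) :
    pathWeight Pt s (n + 1) (Function.update x (n + 1) q) =
      pathWeight Pt s n x * Pt (x n).1 q.1 (q.2 - (x n).2) := by
  unfold pathWeight
  rw [Finset.prod_range_succ, ← mul_assoc]
  have h : ∀ i ≤ n, Function.update x (n + 1) q i = x i := fun i hi =>
    Function.update_of_ne (by omega) _ _
  rw [h 0 (Nat.zero_le n), h n le_rfl, Function.update_self]
  congr 2
  refine Finset.prod_congr rfl fun i hi => ?_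
  rw [Finset.mem_range] at hi
  rw [h i hi.le, h (i + 1) hi]

lemma mem_agreeUpTo_update {α : Type*} {n : ℕ} {x ω : ℕ → α} {q : α} :
    ω ∈ agreeUpTo (n + 1) (Function.update x (n + 1) q) ↔
      ω ∈ agreeUpTo n x ∧ ω (n + 1) = q := by
  constructor
  · intro h
    refine ⟨fun i hi => ?_, by simpa using h (n + 1) le_rfl⟩
    rw [h i (by omega), Function.update_of_ne (by omega)]
  · rintro ⟨h, rfl⟩ i hi
    rcases Nat.le_succ_iff.1 hi with h' | rfl
    · rw [h i h', Function.update_of_ne (by omega)]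
    · rw [Function.update_self]

lemma measurableSet_agreeUpTo {α : Type*} [MeasurableSpace α] [MeasurableSingletonClass α]
    (n : ℕ) (x : ℕ → α) : MeasurableSet (agreeUpTo n x) := by
  have : agreeUpTo n x = ⋂ i, ⋂ _ : i ≤ n, (fun ω : ℕ → α => ω i) ⁻¹' {x i} := by
    ext ω
    simp [agreeUpTo]
  rw [this]
  exact MeasurableSet.iInter fun i => MeasurableSet.iInter fun _ =>
    measurable_pi_apply i (measurableSet_singleton _)

/-- Every trajectory law charging a state `a` forces the passage weights out of `a` to be
summable. -/
lemma summable_of_pathWeight_pos {S : Type*} [DecidableEq S]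
    [MeasurableSpace S] [MeasurableSingletonClass S] {Pt : S → S → ℕ → ℝ}
    (hPt : ∀ a b t, 0 ≤ Pt a b t) {s : S} {μ : Measure (ℕ → S × ℕ)}
    (hμ : ∀ n x, μ (agreeUpTo n x) = ENNReal.ofReal (pathWeight Pt s n x))
    {n : ℕ} {x : ℕ → S × ℕ} (hx : 0 < pathWeight Pt s n x) (b : S) :
    Summable (Pt (x n).1 b) := by
  let A : ℕ → Set (ℕ → S × ℕ) := fun u =>
    agreeUpTo (n + 1) (Function.update x (n + 1) (b, (x n).2 + u))
  have hA : ∀ u, μ (A u) = ENNReal.ofReal (pathWeight Pt s n x * Pt (x n).1 b u) := fun u => by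
    simp only [A, hμ, pathWeight_update, Nat.add_sub_cancel_left]
  have hdisj : Pairwise (Function.onFun Disjoint A) := fun u v huv =>
    Set.disjoint_left.2 fun ω hu hv => huv (by
      have h1 := (mem_agreeUpTo_update.1 hu).2
      have h2 := (mem_agreeUpTo_update.1 hv).2
      rw [h1, Prod.mk.injEq] at h2
      omega)
  have hle : ∑' u, μ (A u) ≤ μ (agreeUpTo n x) := by
    rw [← measure_iUnion hdisj fun u => measurableSet_agreeUpTo _ _]
    exact measure_mono (Set.iUnion_subset fun u ω hω => (mem_agreeUpTo_update.1 hω).1)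
  simp only [hA, hμ] at hle
  have hsum := ENNReal.summable_toReal (ne_top_of_le_ne_top ENNReal.ofReal_ne_top hle)
  simp only [ENNReal.toReal_ofReal (mul_nonneg hx.le (hPt _ _ _))] at hsum
  exact (summable_mul_left_iff hx.ne').1 hsum

/-- Along a chain of states with positive transition weights there is a path of positive
weight. -/
lemma exists_pathWeight_pos {S : Type*} [DecidableEq S] {Pt : S → S → ℕ → ℝ} {s : S}
    {c : ℕ → S} (hc0 : c 0 = s) {ℓ : ℕ}
    (hc : ∀ k < ℓ, 0 < ∑' t : ℕ, Pt (c k) (c (k + 1)) t) :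
    ∃ x : ℕ → S × ℕ, (x ℓ).1 = c ℓ ∧ 0 < pathWeight Pt s ℓ x := by
  induction ℓ with
  | zero => exact ⟨fun _ => (s, 0), hc0.symm, by simp [pathWeight]⟩
  | succ ℓ ih =>
    obtain ⟨x, hx, hpos⟩ := ih fun k hk => hc k (by omega)
    have : ∃ t, 0 < Pt (c ℓ) (c (ℓ + 1)) t := by
      by_contra! h
      exact (hc ℓ (by omega)).not_ge (tsum_nonpos h)
    obtain ⟨t, ht⟩ := this
    refine ⟨Function.update x (ℓ + 1) (c (ℓ + 1), (x ℓ).2 + t), by simp, ?_⟩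
    rw [pathWeight_update, hx, Nat.add_sub_cancel_left]
    exact mul_pos hpos ht

/-- A sequence with exponentially decaying tail has a generating function which is finite
slightly to the right of `1` and right-continuous there. -/
lemma eventually_summable_and_tendsto_genFun {p : ℕ → ℝ} (hp : ∀ t, 0 ≤ p t)
    {C r : ℝ} (hr : r ∈ Set.Ioo (0 : ℝ) 1) {T₀ : ℕ} (h : ∀ t ≥ T₀, p t ≤ C * r ^ t) :
    (∀ᶠ z in 𝓝[>] (1 : ℝ), Summable fun t => p t * z ^ t) ∧
      Tendsto (fun z : ℝ => ∑' t, p t * z ^ t) (𝓝[>] 1) (𝓝 (∑' t, p t)) := by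
  have hr1 : 1 < r⁻¹ := (one_lt_inv₀ hr.1).2 hr.2
  obtain ⟨z₀, hz₀, hz₀r⟩ := exists_between hr1
  have hz₀pos : 0 < z₀ := by linarith
  have hrz : r * z₀ < 1 := by
    have := mul_lt_mul_of_pos_left hz₀r hr.1
    rwa [mul_inv_cancel₀ hr.1.ne'] at this
  have hsum : Summable fun t => p t * z₀ ^ t := by
    refine Summable.of_norm_bounded_eventually_nat
      ((summable_geometric_of_lt_one (mul_pos hr.1 hz₀pos).le hrz).mul_left C) ?_
    filter_upwards [eventually_ge_atTop T₀] with t ht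
    rw [Real.norm_of_nonneg (mul_nonneg (hp t) (by positivity)), mul_pow, ← mul_assoc]
    exact mul_le_mul_of_nonneg_right (h t ht) (by positivity)
  have hbound : ∀ᶠ z in 𝓝[>] (1 : ℝ), ∀ t, ‖p t * z ^ t‖ ≤ p t * z₀ ^ t := by
    filter_upwards [Ioo_mem_nhdsGT hz₀] with z hz t
    have hz0 : 0 ≤ z := by linarith [hz.1]
    rw [Real.norm_of_nonneg (mul_nonneg (hp t) (by positivity))]
    exact mul_le_mul_of_nonneg_left (pow_le_pow_left₀ hz0 hz.2.le t) (hp t)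
  refine ⟨hbound.mono fun z hz => Summable.of_norm_bounded hsum hz, ?_⟩
  refine tendsto_tsum_of_dominated_convergence hsum (fun t => ?_) hbound
  have : Tendsto (fun z : ℝ => p t * z ^ t) (𝓝 1) (𝓝 (p t * 1 ^ t)) :=
    (continuous_const.mul (continuous_pow t)).tendsto 1
  simpa using this.mono_left nhdsWithin_le_nhds

/-- If `s'` is reachable from everywhere, the transition matrix `P` killed at `s'` has a
nonnegative strictly superharmonic function. -/
lemma exists_superharmonic {S : Type*} [Fintype S] [DecidableEq S] {P : S → S → ℝ}
    (hP : ∀ a b, 0 ≤ P a b) (hP1 : ∀ a, ∑ b, P a b = 1) (s' : S)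
    (hreach : ∀ a, ∃ ℓ : ℕ, 1 ≤ ℓ ∧ ∃ c : ℕ → S,
      c 0 = a ∧ c ℓ = s' ∧ ∀ k < ℓ, 0 < P (c k) (c (k + 1))) :
    ∃ W : S → ℝ, (∀ a, 0 ≤ W a) ∧
      ∀ a, ∑ b, P a b * (if b = s' then 0 else W b) < W a := by
  classical
  have hε : ∃ ε ∈ Set.Ioo (0 : ℝ) 1, ∀ a b, 0 < P a b → ε < P a b := by
    have h : ∀ᶠ ε in 𝓝[>] (0 : ℝ), ∀ a b, 0 < P a b → ε < P a b := by
      simp only [eventually_all]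
      exact fun a b hab => mem_nhdsWithin_of_mem_nhds (Iio_mem_nhds hab)
    exact (Filter.Eventually.and (Ioo_mem_nhdsGT (zero_lt_one' ℝ)) h).exists
  obtain ⟨ε, hε01, hε⟩ := hε
  let d : S → ℕ := fun a => Nat.find (hreach a)
  have hd : ∀ a, 1 ≤ d a := fun a => (Nat.find_spec (hreach a)).1
  refine ⟨fun a => 1 - ε ^ d a, fun a => sub_nonneg.2 (pow_le_one₀ hε01.1.le hε01.2.le),
    fun a => ?_⟩
  let U : S → ℝ := fun b => if b = s' then 1 else ε ^ d b
  have hU : ∀ b, 0 ≤ U b := fun b => by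
    have := hε01.1
    simp only [U]
    split_ifs <;> positivity
  have hsum : ∑ b, P a b * (if b = s' then 0 else 1 - ε ^ d b) = 1 - ∑ b, P a b * U b := by
    rw [eq_sub_iff_add_eq, ← Finset.sum_add_distrib]
    refine Eq.trans ?_ (hP1 a)
    refine Finset.sum_congr rfl fun b _ => ?_
    simp only [U]
    split_ifs <;> ring
  rw [hsum]
  refine sub_lt_sub_left ?_ 1
  obtain ⟨c, hc0, hcd, hc⟩ := (Nat.find_spec (hreach a)).2
  change c (d a) = s' at hcd
  change ∀ k < d a, _ at hc
  have hda := hd a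
  have hPc : 0 < P a (c 1) := by simpa [hc0] using hc 0 (by omega)
  have hUc : ε ^ (d a - 1) ≤ U (c 1) := by
    simp only [U]
    split_ifs with h
    · exact pow_le_one₀ hε01.1.le hε01.2.le
    · refine pow_le_pow_of_le_one hε01.1.le hε01.2.le ?_
      have hne : d a ≠ 1 := fun h1 => h (by rw [← h1, hcd])
      refine Nat.find_min' (hreach (c 1)) ⟨by omega, fun k => c (k + 1), rfl, ?_, ?_⟩
      · change c (d a - 1 + 1) = s'
        rw [Nat.sub_add_cancel hda, hcd]
      · exact fun k hk => hc (k + 1) (by omega)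
  calc ε ^ d a = ε * ε ^ (d a - 1) := by rw [← pow_succ', Nat.sub_add_cancel hda]
    _ < P a (c 1) * ε ^ (d a - 1) :=
        mul_lt_mul_of_pos_right (hε _ _ hPc) (pow_pos hε01.1 _)
    _ ≤ P a (c 1) * U (c 1) := mul_le_mul_of_nonneg_left hUc hPc.le
    _ ≤ ∑ b, P a b * U b :=
        Finset.single_le_sum (f := fun b => P a b * U b)
          (fun b _ => mul_nonneg (hP a b) (hU b)) (Finset.mem_univ (c 1))

/-- A strict drift inequality for the transition matrix persists for the generating functions
`∑' t, Pt a b t * z ^ t` with `z` slightly larger than `1`. -/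
lemma exists_drift {S : Type*} [Fintype S] [DecidableEq S] {Pt : S → S → ℕ → ℝ}
    (hPt : ∀ a b t, 0 ≤ Pt a b t)
    (hP1 : ∀ a, ∑ b, (∑' t : ℕ, Pt a b t) = 1) (s' : S)
    (hreach : ∀ a, ∃ ℓ : ℕ, 1 ≤ ℓ ∧ ∃ c : ℕ → S,
      c 0 = a ∧ c ℓ = s' ∧ ∀ k < ℓ, 0 < ∑' t : ℕ, Pt (c k) (c (k + 1)) t)
    (htails : ∀ a b, ∃ C : ℝ, ∃ r ∈ Set.Ioo (0 : ℝ) 1, ∃ T₀ : ℕ, ∀ t ≥ T₀,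
      Pt a b t ≤ C * r ^ t) :
    ∃ z : ℝ, 1 < z ∧ (∀ a b, Summable fun t => Pt a b t * z ^ t) ∧
      ∃ V : S → ℝ, (∀ a, 1 ≤ V a) ∧
        ∀ a, ∑ b, (∑' t, Pt a b t * z ^ t) * (if b = s' then 1 else V b) ≤ V a := by
  obtain ⟨W, hW0, hW⟩ := exists_superharmonic (P := fun a b => ∑' t, Pt a b t)
    (fun a b => tsum_nonneg (hPt a b)) hP1 s' hreach
  have hK : ∃ K : ℝ, 0 ≤ K ∧
      ∀ a, 1 < K * (W a - ∑ b, (∑' t, Pt a b t) * (if b = s' then 0 else W b)) := by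
    have h : ∀ᶠ K : ℝ in atTop, ∀ a,
        1 < K * (W a - ∑ b, (∑' t, Pt a b t) * (if b = s' then 0 else W b)) := by
      rw [eventually_all]
      exact fun a => (tendsto_id.atTop_mul_const (sub_pos.2 (hW a))).eventually_gt_atTop 1
    exact ((eventually_ge_atTop 0).and h).exists
  obtain ⟨K, hK0, hK⟩ := hK
  let V : S → ℝ := fun a => 1 + K * W a
  have hV1 : ∀ a, 1 ≤ V a := fun a => le_add_of_nonneg_right (mul_nonneg hK0 (hW0 a))
  have hV : ∀ a, ∑ b, (∑' t, Pt a b t) * (if b = s' then 1 else V b) < V a := fun a => by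
    have : ∑ b, (∑' t, Pt a b t) * (if b = s' then 1 else V b) =
        ∑ b, (∑' t, Pt a b t) +
          K * ∑ b, (∑' t, Pt a b t) * (if b = s' then 0 else W b) := by
      rw [Finset.mul_sum, ← Finset.sum_add_distrib]
      refine Finset.sum_congr rfl fun b _ => ?_
      simp only [V]
      split_ifs <;> ring
    rw [this, hP1]
    have := hK a
    simp only [V]
    linarith
  have hgen : ∀ a b, (∀ᶠ z in 𝓝[>] (1 : ℝ), Summable fun t => Pt a b t * z ^ t) ∧
      Tendsto (fun z : ℝ => ∑' t, Pt a b t * z ^ t) (𝓝[>] 1) (𝓝 (∑' t, Pt a b t)) :=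
    fun a b => by
      obtain ⟨C, r, hr, T₀, h⟩ := htails a b
      exact eventually_summable_and_tendsto_genFun (hPt a b) hr h
  have h1 : ∀ᶠ z in 𝓝[>] (1 : ℝ), ∀ a b, Summable fun t => Pt a b t * z ^ t := by
    simp only [eventually_all]
    exact fun a b => (hgen a b).1
  have h2 : ∀ᶠ z in 𝓝[>] (1 : ℝ),
      ∀ a, ∑ b, (∑' t, Pt a b t * z ^ t) * (if b = s' then 1 else V b) < V a := by
    rw [eventually_all]
    exact fun a => (tendsto_finsetSum _ fun b _ => (hgen a b).2.mul_const _).eventually_lt_const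
      (hV a)
  obtain ⟨z, hz, hz1, hz2⟩ := (eventually_mem_nhdsWithin.and (h1.and h2)).exists
  exact ⟨z, hz, hz1, V, hV1, fun a => (hz2 a).le⟩

/-- The drift inequality bounds the probability of a path followed by a first passage to `s'` at
time `T`. -/
lemma measure_agreeUpTo_inter_passageAfter_le {S : Type*} [Fintype S] [DecidableEq S]
    [MeasurableSpace S] {Pt : S → S → ℕ → ℝ} (hPt0 : ∀ a b, Pt a b 0 = 0)
    (hPt : ∀ a b t, 0 ≤ Pt a b t) {s s' : S} {μ : Measure (ℕ → S × ℕ)}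
    (hμ : ∀ n x, μ (agreeUpTo n x) = ENNReal.ofReal (pathWeight Pt s n x))
    {z : ℝ} (hz : 1 < z) (hsum : ∀ a b, Summable fun t => Pt a b t * z ^ t)
    {V : S → ℝ} (hV1 : ∀ a, 1 ≤ V a)
    (hV : ∀ a, ∑ b, (∑' t, Pt a b t * z ^ t) * (if b = s' then 1 else V b) ≤ V a)
    (T n : ℕ) (x : ℕ → S × ℕ) :
    μ (agreeUpTo n x ∩ passageAfter s' T n) ≤
      ENNReal.ofReal (pathWeight Pt s n x * (V (x n).1 * z ^ (x n).2 / z ^ T)) := by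
  have hz0 : 0 < z := by linarith
  suffices H : ∀ k n x, T ≤ (x n).2 + k → μ (agreeUpTo n x ∩ passageAfter s' T n) ≤
      ENNReal.ofReal (pathWeight Pt s n x * (V (x n).1 * z ^ (x n).2 / z ^ T)) from
    H T n x (Nat.le_add_left _ _)
  intro k
  induction k with
  | zero =>
    intro n x hT
    refine (measure_mono Set.inter_subset_left).trans ?_
    rw [hμ]
    refine ENNReal.ofReal_le_ofReal (le_mul_of_one_le_right (pathWeight_nonneg hPt s n x) ?_)
    rw [one_le_div (pow_pos hz0 T)]
    exact (pow_le_pow_right₀ hz.le hT).trans (le_mul_of_one_le_left (by positivity) (hV1 _))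
  | succ k ih =>
    intro n x hT
    have hw := pathWeight_nonneg hPt s n x
    set w := pathWeight Pt s n x
    set a := (x n).1
    set t := (x n).2
    let V' : S → ℝ := fun b => if b = s' then 1 else V b
    have hV' : ∀ b, 0 ≤ V' b := fun b => by
      simp only [V']
      split_ifs
      · exact zero_le_one
      · exact zero_le_one.trans (hV1 b)
    let y : S × ℕ → ℕ → S × ℕ := fun q => Function.update x (n + 1) q
    have hy : ∀ q, pathWeight Pt s (n + 1) (y q) = w * Pt a q.1 (q.2 - t) :=
      pathWeight_update Pt s n x
    have hcover : agreeUpTo n x ∩ passageAfter s' T n ⊆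
        ⋃ q, agreeUpTo (n + 1) (y q) ∩ passageAfter s' T n := fun ω hω =>
      Set.mem_iUnion.2 ⟨ω (n + 1), mem_agreeUpTo_update.2 ⟨hω.1, rfl⟩, hω.2⟩
    have hterm : ∀ q : S × ℕ, μ (agreeUpTo (n + 1) (y q) ∩ passageAfter s' T n) ≤
        ENNReal.ofReal (w * V' q.1 / z ^ T * (Pt a q.1 (q.2 - t) * z ^ q.2)) := by
      rintro ⟨b, u⟩
      rcases le_or_gt u t with hut | hut
      · refine (measure_mono Set.inter_subset_left).trans ?_
        rw [hμ, hy]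
        simp [Nat.sub_eq_zero_of_le hut, hPt0]
      by_cases hb : b = s'
      · subst hb
        by_cases hu : u = T
        · refine (measure_mono Set.inter_subset_left).trans ?_
          rw [hμ, hy]
          refine ENNReal.ofReal_le_ofReal (le_of_eq ?_)
          simp only [V', hu, if_true]
          field_simp
        · refine (measure_mono (t := ∅) ?_).trans (by simp)
          rintro ω ⟨h1, m, hm, hk, hωm⟩
          have hq := (mem_agreeUpTo_update.1 h1).2
          rcases hm.eq_or_lt with rfl | hm
          · rw [hq, Prod.mk.injEq] at hωm
            exact hu hωm.2
          · exact hk (n + 1) le_rfl hm (by rw [hq])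
      · have hsub : agreeUpTo (n + 1) (y (b, u)) ∩ passageAfter s' T n ⊆
            agreeUpTo (n + 1) (y (b, u)) ∩ passageAfter s' T (n + 1) := by
          rintro ω ⟨h1, m, hm, hk, hωm⟩
          have hq := (mem_agreeUpTo_update.1 h1).2
          have hne : n + 1 ≠ m := by
            rintro rfl
            rw [hq, Prod.mk.injEq] at hωm
            exact hb hωm.1
          exact ⟨h1, m, by omega, fun k hk1 hk2 => hk k (by omega) hk2, hωm⟩
        have hyn : y (b, u) (n + 1) = (b, u) := Function.update_self _ _ _
        refine (measure_mono hsub).trans ((ih (n + 1) (y (b, u)) ?_).trans ?_)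
        · rw [hyn]
          change T ≤ u + k
          omega
        · rw [hy, hyn]
          refine ENNReal.ofReal_le_ofReal (le_of_eq ?_)
          simp only [V', hb, if_false]
          ring
    have hrow : ∀ b, ∑' u : ℕ, ENNReal.ofReal
        (w * V' b / z ^ T * (Pt a b (u - t) * z ^ u)) =
        ENNReal.ofReal (w * z ^ t / z ^ T * ((∑' v, Pt a b v * z ^ v) * V' b)) := fun b => by
      have hinj : Function.Injective fun v : ℕ => t + v := add_right_injective t
      rw [← hinj.tsum_eq]
      · simp only [Nat.add_sub_cancel_left]
        rw [← ENNReal.ofReal_tsum_of_nonneg]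
        · congr 1
          rw [mul_comm (∑' v, _), ← mul_assoc, ← tsum_mul_left]
          exact tsum_congr fun v => by ring
        · exact fun v => mul_nonneg (div_nonneg (mul_nonneg hw (hV' b)) (by positivity))
            (mul_nonneg (hPt _ _ _) (by positivity))
        · refine ((hsum a b).mul_left (w * V' b / z ^ T * z ^ t)).congr fun v => ?_
          ring
      · intro u hu
        by_contra hne
        refine hu ?_
        have : u - t = 0 := by
          by_contra h0
          exact hne ⟨u - t, by simp only; omega⟩
        simp [this, hPt0]
    calc μ (agreeUpTo n x ∩ passageAfter s' T n)
        ≤ ∑' q, μ (agreeUpTo (n + 1) (y q) ∩ passageAfter s' T n) :=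
          (measure_mono hcover).trans (measure_iUnion_le _)
      _ ≤ ∑' q : S × ℕ,
            ENNReal.ofReal (w * V' q.1 / z ^ T * (Pt a q.1 (q.2 - t) * z ^ q.2)) :=
          ENNReal.tsum_le_tsum hterm
      _ = ∑ b, ENNReal.ofReal (w * z ^ t / z ^ T * ((∑' v, Pt a b v * z ^ v) * V' b)) := by
          rw [ENNReal.tsum_prod', tsum_fintype]
          exact Finset.sum_congr rfl fun b _ => hrow b
      _ = ENNReal.ofReal (w * z ^ t / z ^ T * ∑ b, (∑' v, Pt a b v * z ^ v) * V' b) := by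
          rw [Finset.mul_sum, ENNReal.ofReal_sum_of_nonneg]
          exact fun b _ => mul_nonneg (by positivity) (mul_nonneg
            (tsum_nonneg fun v => mul_nonneg (hPt _ _ _) (by positivity)) (hV' b))
      _ ≤ ENNReal.ofReal (w * z ^ t / z ^ T * V a) :=
          ENNReal.ofReal_le_ofReal (mul_le_mul_of_nonneg_left (hV a) (by positivity))
      _ = ENNReal.ofReal (w * (V a * z ^ t / z ^ T)) := by
          congr 1
          ring

lemma ae_zero_eq {S : Type*} [Countable S] [DecidableEq S] [MeasurableSpace S]
    {Pt : S → S → ℕ → ℝ} {s : S} {μ : Measure (ℕ → S × ℕ)}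
    (hμ : ∀ n x, μ (agreeUpTo n x) = ENNReal.ofReal (pathWeight Pt s n x)) :
    ∀ᵐ ω ∂μ, ω 0 = (s, 0) := by
  have h : ∀ q : S × ℕ, ∀ᵐ ω ∂μ, ω 0 = q → q = (s, 0) := fun q => by
    by_cases hq : q = (s, 0)
    · exact Eventually.of_forall fun _ _ => hq
    · refine measure_mono_null (t := agreeUpTo 0 fun _ => q) ?_ ?_
      · intro ω hω i hi
        obtain rfl : i = 0 := by omega
        by_contra hne
        exact hω fun h => (hne h).elim
      · rw [hμ]
        simp [pathWeight, hq]
  filter_upwards [ae_all_iff.2 h] with ω hω using hω _ rfl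

lemma exists_const_mul_inv_pow_le {z : ℝ} (hz : 1 < z) (C : ℝ) :
    ∃ ρ ∈ Set.Ioo (0 : ℝ) 1, ∃ T₁ : ℕ, ∀ T ≥ T₁, C / z ^ T ≤ ρ ^ T := by
  have hz0 : 0 < z := by linarith
  obtain ⟨y, hy1, hyz⟩ := exists_between hz
  refine ⟨y / z, ⟨div_pos (by linarith) hz0, (div_lt_one hz0).2 hyz⟩, ?_⟩
  obtain ⟨T₁, h⟩ := eventually_atTop.1
    ((tendsto_pow_atTop_atTop_of_one_lt hy1).eventually_ge_atTop C)
  refine ⟨T₁, fun T hT => ?_⟩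
  rw [div_pow]
  exact div_le_div_of_nonneg_right (h T hT) (by positivity)

/-- Lemma 5.3: for a Markov renewal (semi-Markov) process with finite irreducible
driving chain, whose passage-time distributions `Pt s s' (·) / P s s'` all have
exponentially decaying tails (class `𝓔`), the first passage time between any two
states is also of class `𝓔`. The process on `S × ℤ_{≥0}`, with transition
probability `P((s₁,t₁) → (s₂,t₂)) = Pt s₁ s₂ (t₂ - t₁)`, started at `(s, 0)`, is
realized as a measure `μ` on `(S × ℕ)^ℕ` characterized by its finite-dimensional
distributions. -/
theorem markov_renewal_first_passage_class_E {S : Type*} [Fintype S] [DecidableEq S]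
    [MeasurableSpace S] [MeasurableSingletonClass S]
    (Pt : S → S → ℕ → ℝ)
    (hPt0 : ∀ s s', Pt s s' 0 = 0)
    (hPtnonneg : ∀ s s' t, 0 ≤ Pt s s' t) (hPtle : ∀ s s' t, Pt s s' t ≤ 1)
    (hstoch : ∀ s, ∑ s' : S, (∑' t : ℕ, Pt s s' t) = 1)
    (hirr : ∀ s s' : S, ∃ ℓ : ℕ, 1 ≤ ℓ ∧ ∃ c : ℕ → S,
      c 0 = s ∧ c ℓ = s' ∧ ∀ k < ℓ, 0 < ∑' t : ℕ, Pt (c k) (c (k + 1)) t)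
    (htails : ∀ s s' : S, (∑' t : ℕ, Pt s s' t) ≠ 0 →
      ∃ r ∈ Set.Ioo (0 : ℝ) 1, ∃ T₀ : ℕ, ∀ t ≥ T₀,
        Pt s s' t / (∑' t' : ℕ, Pt s s' t') ≤ r ^ t)
    (s s' : S)
    (μ : Measure (ℕ → S × ℕ))
    (hμ : ∀ (n : ℕ) (x : ℕ → S × ℕ),
      μ {ω | ∀ i ≤ n, ω i = x i} =
        ENNReal.ofReal ((if x 0 = (s, 0) then (1 : ℝ) else 0) *
          ∏ i ∈ Finset.range n, Pt (x i).1 (x (i + 1)).1 ((x (i + 1)).2 - (x i).2))) :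
    ∃ ρ ∈ Set.Ioo (0 : ℝ) 1, ∃ T₁ : ℕ, ∀ T ≥ T₁,
      μ {ω | ∃ n : ℕ, 1 ≤ n ∧ (∀ k : ℕ, 1 ≤ k → k < n → (ω k).1 ≠ s') ∧
          ω n = (s', T)} ≤
        ENNReal.ofReal (ρ ^ T) := by
  have hμ' : ∀ n x, μ (agreeUpTo n x) = ENNReal.ofReal (pathWeight Pt s n x) := hμ
  have hsummable : ∀ a b, Summable (Pt a b) := fun a b => by
    obtain ⟨ℓ, -, c, hc0, rfl, hc⟩ := hirr s a
    obtain ⟨x, hx, hpos⟩ := exists_pathWeight_pos hc0 hc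
    exact hx ▸ summable_of_pathWeight_pos hPtnonneg hμ' hpos b
  have hdecay : ∀ a b, ∃ C : ℝ, ∃ r ∈ Set.Ioo (0 : ℝ) 1, ∃ T₀ : ℕ, ∀ t ≥ T₀,
      Pt a b t ≤ C * r ^ t := fun a b => by
    by_cases h : ∑' t, Pt a b t = 0
    · have h0 := (hasSum_zero_iff_of_nonneg (hPtnonneg a b)).1 (h ▸ (hsummable a b).hasSum)
      exact ⟨0, 1 / 2, by norm_num, 0, fun t _ => by simp [h0]⟩
    · obtain ⟨r, hr, T₀, hT⟩ := htails a b h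
      refine ⟨∑' t, Pt a b t, r, hr, T₀, fun t ht => ?_⟩
      have hpos : 0 < ∑' t, Pt a b t := (tsum_nonneg (hPtnonneg a b)).lt_of_ne' h
      exact (div_le_iff₀' hpos).1 (hT t ht)
  obtain ⟨z, hz, hsum, V, hV1, hV⟩ :=
    exists_drift hPtnonneg hstoch s' (fun a => hirr a s') hdecay
  obtain ⟨ρ, hρ, T₁, hT₁⟩ := exists_const_mul_inv_pow_le hz (V s)
  refine ⟨ρ, hρ, T₁, fun T hT => ?_⟩
  have hae : passageAfter s' T 0 ≤ᵐ[μ]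
      (agreeUpTo 0 (fun _ => (s, 0)) ∩ passageAfter s' T 0 : Set (ℕ → S × ℕ)) := by
    filter_upwards [ae_zero_eq hμ'] with ω hω hp
    exact ⟨fun i hi => by rw [Nat.le_zero.1 hi, hω], hp⟩
  calc μ (passageAfter s' T 0)
      ≤ μ (agreeUpTo 0 (fun _ => (s, 0)) ∩ passageAfter s' T 0) := measure_mono_ae hae
    _ ≤ ENNReal.ofReal (V s / z ^ T) := by
        simpa [pathWeight] using measure_agreeUpTo_inter_passageAfter_le hPt0 hPtnonneg hμ' hz
          hsum hV1 hV T 0 fun _ => (s, 0)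
    _ ≤ ENNReal.ofReal (ρ ^ T) := ENNReal.ofReal_le_ofReal (hT₁ T hT)
end
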